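/- (Lower bound for the truncated class) Let d ≥ 1 and K ≥ 1 be integers, 0 < h < 1, 0 < a ≤ 1 ≤ A < ∞, and let w_K(j) = 2^{dj} for j ≤ K and w_K(j) = 2^{dK} for j > K; let P_K^(d) = P_{w_K,h,a,A}. Then there exists a constant C' > 0 depending only on K, d, h, a, A such that for every n ≥ 1, inf over all classifiers f̂_n of sup over π ∈ P_K^(d) of E_{π^⊗n}[R(f̂_n) − R(f*)] ≥ C' · n^{−1}. -/

import Mathlib

open MeasureTheory Set
open scoped ENNReal

noncomputable section

/-- Points of `ℝ^d`. -/
abbrev Pt (d : ℕ) : Type := Fin d → ℝ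

/-- The unit cube `[0,1]^d`. -/
def unitCube (d : ℕ) : Set (Pt d) := Set.Icc 0 1

/-- Lebesgue measure `λ_d` on `[0,1]^d`. -/
def lamd (d : ℕ) : Measure (Pt d) := volume.restrict (unitCube d)

/-- The dyadic subinterval of `[0,1]` at level `j` with index `k`:
`[k 2^{-j}, (k+1) 2^{-j})` for `k < 2^j - 1` and `[1 - 2^{-j}, 1]` for `k = 2^j - 1`. -/
def dyadicI (j k : ℕ) : Set ℝ :=
  if k = 2 ^ j - 1 then Set.Icc (1 - ((2 : ℝ) ^ j)⁻¹) 1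
  else Set.Ico ((k : ℝ) / 2 ^ j) (((k : ℝ) + 1) / 2 ^ j)

/-- The dyadic cube `I_k^{(j)} ⊆ [0,1]^d` at level `j` with multi-index `k`. -/
def dyadicCube (d j : ℕ) (k : Fin d → ℕ) : Set (Pt d) :=
  {x | ∀ i, x i ∈ dyadicI j (k i)}

/-- `f` is represented by the (automatically countable) family `T` of pairwise disjoint
dyadic cubes whose union has full Lebesgue measure in `[0,1]^d`, with `f` constant
on each cube of the family. -/
def IsDyadicRep (d : ℕ) (f : Pt d → ℝ) (T : Set (ℕ × (Fin d → ℕ))) : Prop :=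
  (∀ p ∈ T, ∀ i, p.2 i < 2 ^ p.1) ∧
  (T.PairwiseDisjoint fun p => dyadicCube d p.1 p.2) ∧
  lamd d (unitCube d \ ⋃ p ∈ T, dyadicCube d p.1 p.2) = 0 ∧
  (∀ p ∈ T, ∀ x ∈ dyadicCube d p.1 p.2, ∀ y ∈ dyadicCube d p.1 p.2, f x = f y)

/-- The class `F^(d)` of measurable `{-1,1}`-valued functions admitting a dyadic
representation. -/
def memF (d : ℕ) (f : Pt d → ℝ) : Prop :=
  Measurable f ∧ (∀ x, f x = 1 ∨ f x = -1) ∧ ∃ T, IsDyadicRep d f T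

/-- The class `F_w^(d)`: a dyadic representation with at most `w j` cubes of side
`2^{-j}` for every level `j`. -/
def memFw (d : ℕ) (w : ℕ → ℝ) (f : Pt d → ℝ) : Prop :=
  Measurable f ∧ (∀ x, f x = 1 ∨ f x = -1) ∧
    ∃ T, IsDyadicRep d f T ∧
      ∀ j, ((T ∩ {p | p.1 = j}).encard : ℝ≥0∞) ≤ ENNReal.ofReal (w j)

/-- Marginal `P^X` of `π` on `[0,1]^d`. -/
def margX {d : ℕ} (π : Measure (Pt d × ℝ)) : Measure (Pt d) := π.map Prod.fst

/-- The labels of `π` lie in `{-1, 1}` almost surely. -/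
def Labels {d : ℕ} (π : Measure (Pt d × ℝ)) : Prop := π {p | p.2 = 1 ∨ p.2 = -1} = 1

/-- `η` is the regression function (conditional probability of `Y = 1`) of `π`. -/
def IsRegression {d : ℕ} (π : Measure (Pt d × ℝ)) (η : Pt d → ℝ) : Prop :=
  Measurable η ∧ (∀ x, η x ∈ Set.Icc (0 : ℝ) 1) ∧
    ∀ s : Set (Pt d), MeasurableSet s →
      π (s ×ˢ {(1 : ℝ)}) = ∫⁻ x in s, ENNReal.ofReal (η x) ∂(margX π)

/-- The Bayes rule `f*` associated with the regression function `η`. -/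
def bayes {d : ℕ} (η : Pt d → ℝ) (x : Pt d) : ℝ := if 1 / 2 ≤ η x then 1 else -1

/-- Misclassification risk `R(f) = π({(x,y) : f(x) ≠ y})`. -/
def risk {d : ℕ} (π : Measure (Pt d × ℝ)) (f : Pt d → ℝ) : ℝ :=
  (π {p | f p.1 ≠ p.2}).toReal

/-- Assumption (A1): `P^X` is absolutely continuous w.r.t. `λ_d` with density
between `a` and `A`. -/
def A1cond {d : ℕ} (π : Measure (Pt d × ℝ)) (a A : ℝ) : Prop :=
  ∀ s : Set (Pt d), MeasurableSet s →
    ENNReal.ofReal a * lamd d s ≤ margX π s ∧ margX π s ≤ ENNReal.ofReal A * lamd d s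

/-- Strong margin assumption (SMA) with margin `h`. -/
def SMAcond {d : ℕ} (π : Measure (Pt d × ℝ)) (η : Pt d → ℝ) (h : ℝ) : Prop :=
  margX π {x | h ≤ |2 * η x - 1|} = 1

/-- Number of indices `i` satisfying `P i`. -/
def cnt (n : ℕ) (P : Fin n → Prop) : ℕ := Nat.card {i // P i}

/-- Index of the level-`J` dyadic interval containing `t ∈ [0,1]`. -/
def dyadicIdx (J : ℕ) (t : ℝ) : ℕ := min ⌊t * 2 ^ J⌋₊ (2 ^ J - 1)

/-- The level-`J` dyadic cube containing `x ∈ [0,1]^d`. -/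
def cubeOf (d J : ℕ) (x : Pt d) : Set (Pt d) := dyadicCube d J fun i => dyadicIdx J (x i)

open Classical in
/-- The dyadic majority-vote classifier `f̂_n^{(J)}` built from the sample `s`. -/
def fhat (d J n : ℕ) (s : Fin n → Pt d × ℝ) (x : Pt d) : ℝ :=
  if (∃ i, (s i).1 ∈ cubeOf d J x) ∧
      cnt n (fun i => (s i).1 ∈ cubeOf d J x ∧ (s i).2 = -1) <
        cnt n (fun i => (s i).1 ∈ cubeOf d J x ∧ (s i).2 = 1)
  then 1 else -1

/-- The `n`-fold product measure `π^{⊗n}` governing the i.i.d. sample. -/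
def sampM {d : ℕ} (π : Measure (Pt d × ℝ)) [SigmaFinite π] (n : ℕ) :
    Measure (Fin n → Pt d × ℝ) := Measure.pi fun _ => π

/-- Expected excess risk `E_{π^{⊗n}}[R(f̂_n) - R(f*)]` of the classifier `F`. -/
def excessExp {d : ℕ} (π : Measure (Pt d × ℝ)) [SigmaFinite π] (η : Pt d → ℝ) (n : ℕ)
    (F : (Fin n → Pt d × ℝ) → Pt d → ℝ) : ℝ :=
  ∫ s, risk π (F s) ∂(sampM π n) - risk π (bayes η)

/-- The class `P_{w,h,a,A}` of probability measures (together with their regression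
functions) satisfying (A1), (SMA), and whose Bayes rule belongs to `F_w^(d)`. -/
def Pclass (d : ℕ) (w : ℕ → ℝ) (h a A : ℝ) :
    Set (ProbabilityMeasure (Pt d × ℝ) × (Pt d → ℝ)) :=
  {p | Labels (p.1 : Measure (Pt d × ℝ)) ∧ IsRegression (p.1 : Measure (Pt d × ℝ)) p.2 ∧
       A1cond (p.1 : Measure (Pt d × ℝ)) a A ∧ SMAcond (p.1 : Measure (Pt d × ℝ)) p.2 h ∧
       memFw d w (bayes p.2)}

end


noncomputable section

/-- The law of `(X, Y)` with `X` uniform on the cube and `P(Y = 1 | X) = η X`. -/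
def uniformLaw {d : ℕ} (η : Pt d → ℝ) : Measure (Pt d × ℝ) :=
  ((lamd d).withDensity fun x => ENNReal.ofReal (η x)).map (fun x => (x, (1 : ℝ))) +
    ((lamd d).withDensity fun x => ENNReal.ofReal (1 - η x)).map fun x => (x, (-1 : ℝ))

end

instance isProbabilityMeasure_lamd (d : ℕ) : IsProbabilityMeasure (lamd d) := by
  constructor
  simp [lamd, unitCube, Real.volume_Icc_pi]

lemma uniformLaw_apply {d : ℕ} {η : Pt d → ℝ} (hη : Measurable η) {B : Set (Pt d × ℝ)}
    (hB : MeasurableSet B) :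
    uniformLaw η B = ∫⁻ x, (ENNReal.ofReal (η x) * B.indicator 1 (x, 1) +
      ENNReal.ofReal (1 - η x) * B.indicator 1 (x, -1)) ∂lamd d := by
  have key : ∀ (c : ℝ) (g : Pt d → ℝ), Measurable g →
      ((lamd d).withDensity fun x => ENNReal.ofReal (g x)).map (fun x => (x, c)) B =
        ∫⁻ x, ENNReal.ofReal (g x) * B.indicator 1 (x, c) ∂lamd d := by
    intro c g hg
    have hm : Measurable fun x : Pt d => (x, c) := by fun_prop
    rw [Measure.map_apply hm hB, withDensity_apply _ (hm hB), ← lintegral_indicator (hm hB)]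
    refine lintegral_congr fun x => ?_
    by_cases hx : (x, c) ∈ B <;> simp [hx]
  have hi : Measurable (B.indicator (1 : Pt d × ℝ → ℝ≥0∞)) := measurable_one.indicator hB
  rw [uniformLaw, Measure.add_apply, key 1 η hη, key (-1) _ (by fun_prop), lintegral_add_left]
  exact hη.ennreal_ofReal.mul (hi.comp (by fun_prop))

lemma margX_uniformLaw {d : ℕ} {η : Pt d → ℝ} (hη : Measurable η)
    (hη01 : ∀ x, η x ∈ Set.Icc (0 : ℝ) 1) : margX (uniformLaw η) = lamd d := by
  ext s hs
  rw [margX, Measure.map_apply measurable_fst hs, uniformLaw_apply hη (measurable_fst hs),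
    ← lintegral_indicator_one hs]
  refine lintegral_congr fun x => ?_
  by_cases hx : x ∈ s
  · simp [hx, ← ENNReal.ofReal_add (hη01 x).1 (sub_nonneg.2 (hη01 x).2)]
  · simp [hx]

lemma isProbabilityMeasure_uniformLaw {d : ℕ} {η : Pt d → ℝ} (hη : Measurable η)
    (hη01 : ∀ x, η x ∈ Set.Icc (0 : ℝ) 1) : IsProbabilityMeasure (uniformLaw η) := by
  constructor
  have := congrArg (fun m => m Set.univ) (margX_uniformLaw hη hη01)
  simpa [margX, Measure.map_apply measurable_fst] using this

lemma labels_uniformLaw {d : ℕ} {η : Pt d → ℝ} (hη : Measurable η)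
    (hη01 : ∀ x, η x ∈ Set.Icc (0 : ℝ) 1) : Labels (uniformLaw η) := by
  have hm : MeasurableSet {p : Pt d × ℝ | p.2 = 1 ∨ p.2 = -1} :=
    (measurable_snd (measurableSet_singleton 1)).union
      (measurable_snd (measurableSet_singleton (-1)))
  rw [Labels, uniformLaw_apply hη hm]
  have : ∀ x, (ENNReal.ofReal (η x) + ENNReal.ofReal (1 - η x)) = 1 := fun x => by
    simp [← ENNReal.ofReal_add (hη01 x).1 (sub_nonneg.2 (hη01 x).2)]
  simp [this]

lemma isRegression_uniformLaw {d : ℕ} {η : Pt d → ℝ} (hη : Measurable η)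
    (hη01 : ∀ x, η x ∈ Set.Icc (0 : ℝ) 1) : IsRegression (uniformLaw η) η := by
  refine ⟨hη, hη01, fun s hs => ?_⟩
  rw [margX_uniformLaw hη hη01, uniformLaw_apply hη (hs.prod (measurableSet_singleton _)),
    ← lintegral_indicator hs]
  refine lintegral_congr fun x => ?_
  by_cases hx : x ∈ s <;> simp [hx, Set.indicator] <;> norm_num

open Classical in
lemma risk_uniformLaw {d : ℕ} {η f : Pt d → ℝ} (hη : Measurable η)
    (hη01 : ∀ x, η x ∈ Set.Icc (0 : ℝ) 1) (hf : Measurable f) (hf1 : ∀ x, f x = 1 ∨ f x = -1) :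
    risk (uniformLaw η) f = ∫ x, (if f x = 1 then 1 - η x else η x) ∂lamd d := by
  have hm : MeasurableSet {p : Pt d × ℝ | f p.1 ≠ p.2} :=
    (measurableSet_eq_fun (hf.comp measurable_fst) measurable_snd).compl
  rw [risk, uniformLaw_apply hη hm, integral_eq_lintegral_of_nonneg_ae]
  · congr 1
    refine lintegral_congr fun x => ?_
    rcases hf1 x with hx | hx <;> simp [hx, Set.indicator] <;> norm_num
  · refine Filter.Eventually.of_forall fun x => ?_
    have := hη01 x
    dsimp
    split_ifs <;> linarith [this.1, this.2]
  · exact (Measurable.ite (hf (measurableSet_singleton 1)) (by fun_prop) hη).aestronglyMeasurable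

lemma measurable_bayes {d : ℕ} {η : Pt d → ℝ} (hη : Measurable η) : Measurable (bayes η) :=
  Measurable.ite (measurableSet_le measurable_const hη) measurable_const measurable_const

lemma bayes_eq_or {d : ℕ} (η : Pt d → ℝ) (x : Pt d) : bayes η x = 1 ∨ bayes η x = -1 := by
  unfold bayes; split_ifs <;> simp

/-- Under a uniform margin `h` on `Q`, the excess risk is at least `h` times the mass of the
points of `Q` misclassified with respect to the Bayes rule. -/
lemma le_risk_sub_risk_bayes {d : ℕ} {η f : Pt d → ℝ} (hη : Measurable η)
    (hη01 : ∀ x, η x ∈ Set.Icc (0 : ℝ) 1) (hf : Measurable f) (hf1 : ∀ x, f x = 1 ∨ f x = -1)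
    {h b : ℝ} {Q : Set (Pt d)} (hQ : MeasurableSet Q) (hh : ∀ x ∈ Q, h ≤ |2 * η x - 1|)
    (hb : ∀ x ∈ Q, bayes η x = b) :
    h * (lamd d).real (Q ∩ {x | f x ≠ b}) ≤
      risk (uniformLaw η) f - risk (uniformLaw η) (bayes η) := by
  classical
  have hint : ∀ g : Pt d → ℝ, Measurable g →
      Integrable (fun x => if g x = 1 then 1 - η x else η x) (lamd d) := fun g hg => by
    refine Integrable.of_bound (C := 1)
      (Measurable.ite (hg (measurableSet_singleton 1)) (by fun_prop) hη).aestronglyMeasurable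
      (Filter.Eventually.of_forall fun x => ?_)
    have := hη01 x
    rw [Real.norm_eq_abs, abs_le]
    split_ifs <;> constructor <;> linarith [this.1, this.2]
  have hS : MeasurableSet (Q ∩ {x | f x ≠ b}) :=
    hQ.inter (hf (measurableSet_singleton b)).compl
  rw [risk_uniformLaw hη hη01 hf hf1,
    risk_uniformLaw hη hη01 (measurable_bayes hη) (bayes_eq_or η),
    ← integral_sub (hint f hf) (hint _ (measurable_bayes hη)), mul_comm, ← smul_eq_mul,
    ← integral_indicator_const h hS]
  refine integral_mono ((integrable_const h).indicator hS)
    ((hint f hf).sub (hint _ (measurable_bayes hη))) fun x => ?_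
  by_cases hx : x ∈ Q ∩ {x | f x ≠ b}
  · have h1 := hh x hx.1
    have h2 := hx.2
    rw [← hb x hx.1] at h2
    simp only [Set.indicator_of_mem hx]
    rcases hf1 x with h3 | h3 <;>
    · by_cases h4 : 1 / 2 ≤ η x
      · rw [abs_of_nonneg (by linarith)] at h1
        revert h2
        norm_num [h3, bayes, h4] <;> linarith
      · rw [abs_of_neg (by linarith)] at h1
        revert h2
        norm_num [h3, bayes, h4] <;> linarith
  · simp only [Set.indicator_of_notMem hx]
    rcases hf1 x with h3 | h3 <;>
    · by_cases h4 : 1 / 2 ≤ η x <;> norm_num [h3, bayes, h4] <;> linarith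

lemma dyadicI_zero {i : ℕ} (hi : 1 ≤ i) : dyadicI i 0 = Set.Ico 0 ((2 : ℝ) ^ i)⁻¹ := by
  have : 2 ≤ 2 ^ i := by simpa using Nat.pow_le_pow_right (n := 2) (by norm_num) hi
  rw [dyadicI, if_neg (by omega)]
  simp

lemma inv_le_of_mem_dyadicI_one {i : ℕ} (hi : 1 ≤ i) {t : ℝ} (ht : t ∈ dyadicI i 1) :
    ((2 : ℝ) ^ i)⁻¹ ≤ t := by
  have h2 : 2 ≤ 2 ^ i := by simpa using Nat.pow_le_pow_right (n := 2) (by norm_num) hi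
  rw [dyadicI] at ht
  split_ifs at ht with h
  · have h3 : (2 : ℝ) ^ i = 2 := by
      have : 2 ^ i = 2 := by omega
      exact_mod_cast this
    rw [h3] at ht ⊢
    linarith [ht.1]
  · simpa using ht.1

lemma mem_dyadicI_one {i : ℕ} (hi : 1 ≤ i) {t : ℝ} (h1 : ((2 : ℝ) ^ i)⁻¹ ≤ t)
    (h2 : t < 2 * ((2 : ℝ) ^ i)⁻¹) : t ∈ dyadicI i 1 := by
  rw [dyadicI]
  split_ifs with h
  · have h4 : 2 ≤ 2 ^ i := by simpa using Nat.pow_le_pow_right (n := 2) (by norm_num) hi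
    have h3 : (2 : ℝ) ^ i = 2 := by
      have : 2 ^ i = 2 := by omega
      exact_mod_cast this
    rw [h3] at h1 h2 ⊢
    constructor <;> linarith
  · constructor
    · simpa using h1
    · rw [div_eq_mul_inv]; norm_num; exact h2

lemma lt_of_mem_dyadicI_of_le_one {i k : ℕ} (hi : 2 ≤ i) (hk : k ≤ 1) {t : ℝ}
    (ht : t ∈ dyadicI i k) : t < 2 * ((2 : ℝ) ^ i)⁻¹ := by
  have h2 : 4 ≤ 2 ^ i := by simpa using Nat.pow_le_pow_right (n := 2) (by norm_num) hi
  rw [dyadicI, if_neg (by omega)] at ht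
  have hk' : (k : ℝ) ≤ 1 := by exact_mod_cast hk
  refine ht.2.trans_le ?_
  rw [div_eq_mul_inv]
  gcongr
  linarith

/-- The dyadic decomposition of the cube along the chain of cubes at the origin, down to
level `j`. -/
def cornerFamily (d j : ℕ) : Set (ℕ × (Fin d → ℕ)) :=
  {p | 1 ≤ p.1 ∧ p.1 ≤ j ∧ (∀ c, p.2 c ≤ 1) ∧ (p.2 = 0 → p.1 = j)}

lemma eq_of_mem_dyadicI {i k k' : ℕ} (hi : 1 ≤ i) (hk : k ≤ 1) (hk' : k' ≤ 1) {t : ℝ}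
    (ht : t ∈ dyadicI i k) (ht' : t ∈ dyadicI i k') : k = k' := by
  interval_cases k <;> interval_cases k' <;> try rfl
  · rw [dyadicI_zero hi] at ht
    exact absurd (inv_le_of_mem_dyadicI_one hi ht') (not_le.2 ht.2)
  · rw [dyadicI_zero hi] at ht'
    exact absurd (inv_le_of_mem_dyadicI_one hi ht) (not_le.2 ht'.2)

lemma level_le_of_mem_cornerFamily {d j : ℕ} {p q : ℕ × (Fin d → ℕ)} (hp : p ∈ cornerFamily d j)
    (hq : q ∈ cornerFamily d j) {x : Pt d} (hxp : x ∈ dyadicCube d p.1 p.2)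
    (hxq : x ∈ dyadicCube d q.1 q.2) : q.1 ≤ p.1 := by
  by_contra! hlt
  have hne : p.2 ≠ 0 := fun h => by
    have := hp.2.2.2 h
    have := hq.2.1
    omega
  obtain ⟨c, hc⟩ := Function.ne_iff.1 hne
  have hc1 : p.2 c = 1 := by
    have := hp.2.2.1 c
    simp only [Pi.zero_apply] at hc
    omega
  have h1 : ((2 : ℝ) ^ p.1)⁻¹ ≤ x c := inv_le_of_mem_dyadicI_one hp.1 (hc1 ▸ hxp c)
  have h2 := lt_of_mem_dyadicI_of_le_one (by have := hp.1; omega) (hq.2.2.1 c) (hxq c)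
  have h3 : 2 * ((2 : ℝ) ^ q.1)⁻¹ ≤ ((2 : ℝ) ^ p.1)⁻¹ := by
    have h4 : ((2 : ℝ) ^ q.1)⁻¹ ≤ ((2 : ℝ) ^ (p.1 + 1))⁻¹ := by
      gcongr
      · norm_num
      · exact hlt
    rw [pow_succ, mul_inv] at h4
    linarith
  linarith

lemma eq_of_mem_cornerFamily {d j : ℕ} {p q : ℕ × (Fin d → ℕ)} (hp : p ∈ cornerFamily d j)
    (hq : q ∈ cornerFamily d j) {x : Pt d} (hxp : x ∈ dyadicCube d p.1 p.2)
    (hxq : x ∈ dyadicCube d q.1 q.2) : p = q := by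
  have h1 : p.1 = q.1 := le_antisymm (level_le_of_mem_cornerFamily hq hp hxq hxp)
    (level_le_of_mem_cornerFamily hp hq hxp hxq)
  refine Prod.ext h1 (funext fun c => ?_)
  exact eq_of_mem_dyadicI hp.1 (hp.2.2.1 c) (hq.2.2.1 c) (hxp c) (h1 ▸ hxq c)

lemma mem_dyadicI_ite {i : ℕ} (hi : 1 ≤ i) {t : ℝ} (h0 : 0 ≤ t) (h2 : t < 2 * ((2 : ℝ) ^ i)⁻¹) :
    t ∈ dyadicI i (if t < ((2 : ℝ) ^ i)⁻¹ then 0 else 1) := by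
  split_ifs with h
  · rw [dyadicI_zero hi]; exact ⟨h0, h⟩
  · exact mem_dyadicI_one hi (not_lt.1 h) h2

lemma exists_mem_cornerFamily {d j : ℕ} (hj : 1 ≤ j) {x : Pt d} (hx : x ∈ unitCube d) :
    ∃ p ∈ cornerFamily d j, x ∈ dyadicCube d p.1 p.2 := by
  induction j, hj using Nat.le_induction with
  | base =>
    refine ⟨(1, fun c => if x c < ((2 : ℝ) ^ 1)⁻¹ then 0 else 1),
      ⟨le_rfl, le_rfl, fun c => by dsimp only; split_ifs <;> simp, fun _ => rfl⟩, fun c => ?_⟩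
    dsimp only
    split_ifs with h
    · rw [dyadicI_zero le_rfl]; exact ⟨hx.1 c, h⟩
    · have := hx.2 c
      norm_num [dyadicI] at h this ⊢
      exact ⟨h, this⟩
  | succ j hj ih =>
    obtain ⟨p, hp, hxp⟩ := ih
    by_cases h0 : p.2 = 0
    · refine ⟨(j + 1, fun c => if x c < ((2 : ℝ) ^ (j + 1))⁻¹ then 0 else 1),
        ⟨by simp, le_rfl, fun c => by dsimp only; split_ifs <;> simp, fun _ => rfl⟩,
        fun c => mem_dyadicI_ite (by simp) (hx.1 c) ?_⟩
      have h1 := hxp c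
      rw [h0, hp.2.2.2 h0, Pi.zero_apply, dyadicI_zero hj] at h1
      have h2 := h1.2
      rw [pow_succ, mul_inv]
      linarith
    · exact ⟨p, ⟨hp.1, hp.2.1.trans (by simp), hp.2.2.1, fun h => absurd h h0⟩, hxp⟩

lemma corner_mem_cornerFamily {d j : ℕ} (hj : 1 ≤ j) :
    (j, (0 : Fin d → ℕ)) ∈ cornerFamily d j :=
  ⟨hj, le_rfl, fun _ => by simp, fun _ => rfl⟩

/-- A function constant on the corner cube and on its complement is represented by
`cornerFamily`. -/
lemma isDyadicRep_cornerFamily {d j : ℕ} (hj : 1 ≤ j) {f : Pt d → ℝ} {u v : ℝ}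
    (hu : ∀ x ∈ dyadicCube d j 0, f x = u) (hv : ∀ x ∉ dyadicCube d j 0, f x = v) :
    IsDyadicRep d f (cornerFamily d j) := by
  refine ⟨fun p hp c => ?_, fun p hp q hq hpq => ?_, ?_, fun p hp x hx y hy => ?_⟩
  · have h2 : 2 ≤ 2 ^ p.1 := by simpa using Nat.pow_le_pow_right (n := 2) (by norm_num) hp.1
    have := hp.2.2.1 c
    omega
  · exact Set.disjoint_left.2 fun x hxp hxq => hpq (eq_of_mem_cornerFamily hp hq hxp hxq)
  · convert measure_empty (μ := lamd d)
    refine Set.sdiff_eq_empty.2 fun x hx => ?_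
    obtain ⟨p, hp, hxp⟩ := exists_mem_cornerFamily hj hx
    exact Set.mem_biUnion hp hxp
  · by_cases h : p = (j, 0)
    · subst h
      rw [hu x hx, hu y hy]
    · rw [hv x fun hx' => h (eq_of_mem_cornerFamily hp (corner_mem_cornerFamily hj) hx hx'),
        hv y fun hy' => h (eq_of_mem_cornerFamily hp (corner_mem_cornerFamily hj) hy hy')]

lemma encard_cornerFamily_level_le (d j i : ℕ) :
    (cornerFamily d j ∩ {p | p.1 = i}).encard ≤ (2 : ℕ∞) ^ d := by
  have hsub : cornerFamily d j ∩ {p | p.1 = i} ⊆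
      (fun k : Fin d → Fin 2 => (i, fun c => (k c : ℕ))) '' Set.univ := by
    rintro ⟨l, k⟩ ⟨hp, rfl⟩
    exact ⟨fun c => ⟨k c, Nat.lt_succ_of_le (hp.2.2.1 c)⟩, trivial, rfl⟩
  refine (Set.encard_le_encard hsub).trans ((Set.encard_image_le _ _).trans ?_)
  simp [Set.encard_univ]

lemma encard_cornerFamily_le (d j K : ℕ) (hK : 1 ≤ K) (i : ℕ) :
    ((cornerFamily d j ∩ {p | p.1 = i}).encard : ℝ≥0∞) ≤
      ENNReal.ofReal (if i ≤ K then (2 : ℝ) ^ (d * i) else (2 : ℝ) ^ (d * K)) := by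
  rcases Nat.eq_zero_or_pos i with rfl | hi
  · have : cornerFamily d j ∩ {p | p.1 = 0} = ∅ := by
      ext p
      simp only [Set.mem_inter_iff, Set.mem_ofPred_eq, Set.mem_empty_iff_false, iff_false, not_and]
      intro hp
      have := hp.1
      omega
    simp [this]
  · have h1 : ((cornerFamily d j ∩ {p | p.1 = i}).encard : ℝ≥0∞) ≤ ((2 : ℕ∞) ^ d : ℕ∞) := by
      exact_mod_cast encard_cornerFamily_level_le d j i
    refine h1.trans ?_
    have h2 : (((2 : ℕ∞) ^ d : ℕ∞) : ℝ≥0∞) = ENNReal.ofReal ((2 : ℝ) ^ d) := by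
      rw [ENNReal.ofReal_pow (by norm_num)]
      simp
    rw [h2]
    refine ENNReal.ofReal_le_ofReal ?_
    split_ifs
    · exact pow_le_pow_right₀ (by norm_num) (Nat.le_mul_of_pos_right d hi)
    · exact pow_le_pow_right₀ (by norm_num) (Nat.le_mul_of_pos_right d hK)

lemma corner_eq_pi {d j : ℕ} (hj : 1 ≤ j) :
    dyadicCube d j 0 = Set.univ.pi fun _ => Set.Ico (0 : ℝ) ((2 : ℝ) ^ j)⁻¹ := by
  ext x
  simp [dyadicCube, dyadicI_zero hj]

lemma measurableSet_corner {d j : ℕ} (hj : 1 ≤ j) : MeasurableSet (dyadicCube d j 0) := by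
  rw [corner_eq_pi hj]
  exact MeasurableSet.univ_pi fun _ => measurableSet_Ico

lemma lamd_real_corner {d j : ℕ} (hj : 1 ≤ j) :
    (lamd d).real (dyadicCube d j 0) = ((2 : ℝ) ^ (d * j))⁻¹ := by
  have hsub : dyadicCube d j 0 ⊆ unitCube d := fun x hx => by
    have hx' : ∀ c, 0 ≤ x c ∧ x c < ((2 : ℝ) ^ j)⁻¹ := by
      simpa [corner_eq_pi hj] using hx
    have h1 : ((2 : ℝ) ^ j)⁻¹ ≤ 1 := inv_le_one_of_one_le₀ (one_le_pow₀ (by norm_num))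
    exact ⟨fun c => (hx' c).1, fun c => ((hx' c).2.le.trans h1)⟩
  rw [lamd, measureReal_restrict_apply (measurableSet_corner hj),
    Set.inter_eq_left.2 hsub, corner_eq_pi hj, measureReal_def, volume_pi_pi]
  simp [Real.volume_Ico, ← pow_mul, mul_comm]

lemma measurable_real_inter_ne {d n : ℕ} {F : (Fin n → Pt d × ℝ) → Pt d → ℝ}
    (hF : Measurable (Function.uncurry F)) {Q : Set (Pt d)} (hQ : MeasurableSet Q) (b : ℝ) :
    Measurable fun s => (lamd d).real (Q ∩ {x | F s x ≠ b}) := by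
  have hS : MeasurableSet {z : (Fin n → Pt d × ℝ) × Pt d | z.2 ∈ Q ∧ F z.1 z.2 ≠ b} :=
    (measurable_snd hQ).inter (hF (measurableSet_singleton b)).compl
  exact (measurable_measure_prodMk_left (ν := lamd d) hS).ennreal_toReal

lemma measurable_risk {d n : ℕ} {π : Measure (Pt d × ℝ)} [SFinite π]
    {F : (Fin n → Pt d × ℝ) → Pt d → ℝ} (hF : Measurable (Function.uncurry F)) :
    Measurable fun s => risk π (F s) := by
  have hS : MeasurableSet {z : (Fin n → Pt d × ℝ) × (Pt d × ℝ) | F z.1 z.2.1 ≠ z.2.2} :=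
    (measurableSet_eq_fun
      (hF.comp (measurable_fst.prodMk (measurable_fst.comp measurable_snd)))
      (measurable_snd.comp measurable_snd)).compl
  exact (measurable_measure_prodMk_left (ν := π) hS).ennreal_toReal

lemma excessExp_le_one {d : ℕ} (π : Measure (Pt d × ℝ)) [IsProbabilityMeasure π]
    (η : Pt d → ℝ) (n : ℕ) (F : (Fin n → Pt d × ℝ) → Pt d → ℝ) : excessExp π η n F ≤ 1 := by
  have : IsProbabilityMeasure (sampM π n) := by unfold sampM; infer_instance
  have h1 : ‖∫ s, risk π (F s) ∂sampM π n‖ ≤ 1 * (sampM π n).real Set.univ :=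
    norm_integral_le_of_norm_le_const <| Filter.Eventually.of_forall fun s => by
      rw [risk, Real.norm_of_nonneg ENNReal.toReal_nonneg]
      exact measureReal_le_one
  have h2 : 0 ≤ risk π (bayes η) := ENNReal.toReal_nonneg
  rw [probReal_univ, mul_one] at h1
  unfold excessExp
  linarith [le_of_abs_le h1]

/-- The expected excess risk dominates `h` times the expected mass misclassified in `Q` on the
event that no design point of the sample falls in `Q`. -/
lemma le_excessExp {d n : ℕ} {η : Pt d → ℝ} (hη : Measurable η)
    (hη01 : ∀ x, η x ∈ Set.Icc (0 : ℝ) 1) [IsProbabilityMeasure (uniformLaw η)]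
    {F : (Fin n → Pt d × ℝ) → Pt d → ℝ} (hF : Measurable (Function.uncurry F))
    (hF1 : ∀ s x, F s x = 1 ∨ F s x = -1) {h b : ℝ} (h0 : 0 ≤ h) {Q : Set (Pt d)}
    (hQ : MeasurableSet Q) (hh : ∀ x ∈ Q, h ≤ |2 * η x - 1|) (hb : ∀ x ∈ Q, bayes η x = b) :
    ∫ s, h * (lamd d).real (Q ∩ {x | F s x ≠ b})
        ∂(Measure.pi fun _ : Fin n => (uniformLaw η).restrict (Qᶜ ×ˢ Set.univ)) ≤
      excessExp (uniformLaw η) η n F := by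
  have hprob : IsProbabilityMeasure (sampM (uniformLaw η) n) := by unfold sampM; infer_instance
  have hint : Integrable (fun s => h * (lamd d).real (Q ∩ {x | F s x ≠ b}))
      (sampM (uniformLaw η) n) := by
    refine Integrable.const_mul (Integrable.of_bound (C := 1)
      (measurable_real_inter_ne hF hQ b).aestronglyMeasurable
      (Filter.Eventually.of_forall fun s => ?_)) h
    rw [Real.norm_of_nonneg measureReal_nonneg]
    exact measureReal_le_one
  have hrisk : Integrable (fun s => risk (uniformLaw η) (F s)) (sampM (uniformLaw η) n) := by
    refine Integrable.of_bound (C := 1) (measurable_risk hF).aestronglyMeasurable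
      (Filter.Eventually.of_forall fun s => ?_)
    rw [risk, Real.norm_of_nonneg ENNReal.toReal_nonneg]
    exact measureReal_le_one
  rw [← Measure.restrict_pi_pi]
  calc _ ≤ ∫ s, h * (lamd d).real (Q ∩ {x | F s x ≠ b}) ∂sampM (uniformLaw η) n :=
        setIntegral_le_integral hint
          (Filter.Eventually.of_forall fun s => mul_nonneg h0 measureReal_nonneg)
    _ ≤ ∫ s, (risk (uniformLaw η) (F s) - risk (uniformLaw η) (bayes η))
          ∂sampM (uniformLaw η) n :=
        integral_mono hint (hrisk.sub (integrable_const _)) fun s =>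
          le_risk_sub_risk_bayes hη hη01 (hF.comp measurable_prodMk_left) (hF1 s) hQ hh hb
    _ = excessExp (uniformLaw η) η n F := by
        rw [integral_sub hrisk (integrable_const _), integral_const, probReal_univ, one_smul,
          excessExp]

lemma restrict_uniformLaw_congr {d : ℕ} {η η' : Pt d → ℝ} (hη : Measurable η)
    (hη' : Measurable η') {Q : Set (Pt d)} (hQ : MeasurableSet Q) (heq : ∀ x ∉ Q, η x = η' x) :
    (uniformLaw η).restrict (Qᶜ ×ˢ Set.univ) = (uniformLaw η').restrict (Qᶜ ×ˢ Set.univ) := by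
  ext B hB
  have hB' : MeasurableSet (B ∩ Qᶜ ×ˢ Set.univ) := hB.inter (hQ.compl.prod .univ)
  rw [Measure.restrict_apply hB, Measure.restrict_apply hB, uniformLaw_apply hη hB',
    uniformLaw_apply hη' hB']
  refine lintegral_congr fun x => ?_
  by_cases hx : x ∈ Q
  · simp [hx]
  · rw [heq x hx]

lemma real_restrict_uniformLaw_univ {d : ℕ} {η : Pt d → ℝ} (hη : Measurable η)
    (hη01 : ∀ x, η x ∈ Set.Icc (0 : ℝ) 1) {Q : Set (Pt d)} (hQ : MeasurableSet Q) :
    ((uniformLaw η).restrict (Qᶜ ×ˢ Set.univ)).real Set.univ = 1 - (lamd d).real Q := by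
  rw [← probReal_compl_eq_one_sub hQ, measureReal_restrict_apply .univ, Set.univ_inter,
    ← margX_uniformLaw hη hη01, margX, measureReal_def, measureReal_def,
    Measure.map_apply measurable_fst hQ.compl, Set.prod_univ]

/-- Two-point bound: if two regression functions agree off `Q` and have opposite Bayes labels on
`Q` with margin `h`, the sum of the expected excess risks is at least `h` times the mass of `Q`
times the probability that the sample avoids `Q`. -/
lemma le_excessExp_add_excessExp {d n : ℕ} {η η' : Pt d → ℝ} (hη : Measurable η)
    (hη' : Measurable η') (hη01 : ∀ x, η x ∈ Set.Icc (0 : ℝ) 1)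
    (hη01' : ∀ x, η' x ∈ Set.Icc (0 : ℝ) 1) [IsProbabilityMeasure (uniformLaw η)]
    [IsProbabilityMeasure (uniformLaw η')] {F : (Fin n → Pt d × ℝ) → Pt d → ℝ}
    (hF : Measurable (Function.uncurry F)) (hF1 : ∀ s x, F s x = 1 ∨ F s x = -1) {h : ℝ}
    (h0 : 0 ≤ h) {Q : Set (Pt d)} (hQ : MeasurableSet Q) (heq : ∀ x ∉ Q, η x = η' x)
    (hh : ∀ x ∈ Q, h ≤ |2 * η x - 1|) (hh' : ∀ x ∈ Q, h ≤ |2 * η' x - 1|)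
    (hb : ∀ x ∈ Q, bayes η x = 1) (hb' : ∀ x ∈ Q, bayes η' x = -1) :
    h * (lamd d).real Q * (1 - (lamd d).real Q) ^ n ≤
      excessExp (uniformLaw η) η n F + excessExp (uniformLaw η') η' n F := by
  have h1 := le_excessExp hη hη01 hF hF1 h0 hQ hh hb
  have h2 := le_excessExp hη' hη01' hF hF1 h0 hQ hh' hb'
  rw [← restrict_uniformLaw_congr hη hη' hQ heq] at h2
  refine le_trans (le_of_eq ?_) (add_le_add h1 h2)
  have hint : ∀ b : ℝ, Integrable (fun s => h * (lamd d).real (Q ∩ {x | F s x ≠ b}))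
      (Measure.pi fun _ : Fin n => (uniformLaw η).restrict (Qᶜ ×ˢ Set.univ)) := fun b => by
    refine Integrable.const_mul (Integrable.of_bound (C := 1)
      (measurable_real_inter_ne hF hQ b).aestronglyMeasurable
      (Filter.Eventually.of_forall fun s => ?_)) h
    rw [Real.norm_of_nonneg measureReal_nonneg]
    exact measureReal_le_one
  rw [← integral_add (hint 1) (hint (-1))]
  have hsum : ∀ s, h * (lamd d).real (Q ∩ {x | F s x ≠ 1}) +
      h * (lamd d).real (Q ∩ {x | F s x ≠ -1}) = h * (lamd d).real Q := fun s => by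
    have hFs : MeasurableSet {x | F s x ≠ 1} :=
      ((hF.comp measurable_prodMk_left) (measurableSet_singleton 1)).compl
    have hset : Q ∩ {x | F s x ≠ -1} = Q \ {x | F s x ≠ 1} := by
      ext x
      rcases hF1 s x with hx | hx <;> simp [hx] <;> norm_num
    rw [← mul_add, hset, measureReal_inter_add_sdiff hFs]
  simp_rw [hsum]
  rw [integral_const, smul_eq_mul, mul_comm, measureReal_def (Measure.pi _), Measure.pi_univ]
  simp only [Finset.prod_const, Finset.card_univ, Fintype.card_fin, ENNReal.toReal_pow,
    ← measureReal_def, real_restrict_uniformLaw_univ hη hη01 hQ]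

open Classical in
/-- The regression function equal to `c` on the corner cube of level `j` and to `(1 - h) / 2`
elsewhere. -/
noncomputable def cornerEta (d j : ℕ) (h c : ℝ) (x : Pt d) : ℝ :=
  if x ∈ dyadicCube d j 0 then c else (1 - h) / 2

lemma bayes_cornerEta {d j : ℕ} {h c : ℝ} {x : Pt d} (hx : x ∈ dyadicCube d j 0) :
    bayes (cornerEta d j h c) x = if 1 / 2 ≤ c then 1 else -1 := by
  simp [bayes, cornerEta, hx]

lemma measurable_cornerEta {d j : ℕ} (hj : 1 ≤ j) (h c : ℝ) : Measurable (cornerEta d j h c) :=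
  Measurable.ite (measurableSet_corner hj) measurable_const measurable_const

lemma abs_two_mul_cornerEta_sub_one {d j : ℕ} {h c : ℝ} (h0 : 0 ≤ h) (hc : |2 * c - 1| = h)
    (x : Pt d) : |2 * cornerEta d j h c x - 1| = h := by
  unfold cornerEta
  split_ifs
  · exact hc
  · rw [abs_of_nonpos] <;> linarith

lemma cornerEta_mem_Icc {d j : ℕ} {h c : ℝ} (h0 : 0 ≤ h) (h1 : h ≤ 1) (hc : |2 * c - 1| = h)
    (x : Pt d) : cornerEta d j h c x ∈ Set.Icc (0 : ℝ) 1 := by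
  have := abs_le.1 (abs_two_mul_cornerEta_sub_one (j := j) h0 hc x).le
  constructor <;> linarith [this.1, this.2]

lemma uniformLaw_cornerEta_mem_Pclass {d j K : ℕ} (hj : 1 ≤ j) (hK : 1 ≤ K) {h a A c : ℝ}
    (h0 : 0 ≤ h) (h1 : h ≤ 1) (ha1 : a ≤ 1) (hA : 1 ≤ A) (hc : |2 * c - 1| = h)
    (hp : IsProbabilityMeasure (uniformLaw (cornerEta d j h c))) :
    ((⟨uniformLaw (cornerEta d j h c), hp⟩, cornerEta d j h c) :
        ProbabilityMeasure (Pt d × ℝ) × (Pt d → ℝ)) ∈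
      Pclass d (fun j => if j ≤ K then (2 : ℝ) ^ (d * j) else (2 : ℝ) ^ (d * K)) h a A := by
  have hm := measurable_cornerEta (d := d) hj h c
  have h01 := cornerEta_mem_Icc (d := d) (j := j) h0 h1 hc
  have hmarg := margX_uniformLaw hm h01
  refine ⟨labels_uniformLaw hm h01, isRegression_uniformLaw hm h01, fun s _ => ?_, ?_,
    measurable_bayes hm, bayes_eq_or _, cornerFamily d j,
    isDyadicRep_cornerFamily hj (u := if 1 / 2 ≤ c then 1 else -1)
      (v := if 1 / 2 ≤ (1 - h) / 2 then 1 else -1) (fun x hx => ?_) (fun x hx => ?_),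
    encard_cornerFamily_le d j K hK⟩
  · change ENNReal.ofReal a * lamd d s ≤ margX (uniformLaw _) s ∧
      margX (uniformLaw _) s ≤ ENNReal.ofReal A * lamd d s
    rw [hmarg]
    constructor
    · exact mul_le_of_le_one_left' (ENNReal.ofReal_le_one.2 ha1)
    · exact le_mul_of_one_le_left' (ENNReal.one_le_ofReal.2 hA)
  · change margX (uniformLaw _) _ = 1
    simp [hmarg, abs_two_mul_cornerEta_sub_one h0 hc]
  · exact bayes_cornerEta hx
  · simp [bayes, cornerEta, hx]

/-- **Lower bound for the truncated class.** On
`P_K^(d) = P_{w_K,h,a,A}` no classifier can beat the rate `n^{-1}`. -/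
theorem truncated_class_lower_bound (d K : ℕ) (hd : 1 ≤ d) (hK : 1 ≤ K)
    (h a A : ℝ) (hh : 0 < h) (hh1 : h < 1) (ha : 0 < a) (ha1 : a ≤ 1) (hA : 1 ≤ A) :
    ∃ C' : ℝ, 0 < C' ∧ ∀ n : ℕ, 1 ≤ n →
      ∀ F : (Fin n → Pt d × ℝ) → Pt d → ℝ, Measurable (Function.uncurry F) →
        (∀ s x, F s x = 1 ∨ F s x = -1) →
          C' / n ≤
            ⨆ p : ↥(Pclass d
                (fun j => if j ≤ K then (2 : ℝ) ^ (d * j) else (2 : ℝ) ^ (d * K)) h a A),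
              excessExp (p.1.1 : Measure (Pt d × ℝ)) p.1.2 n F := by
  have hB : (1 : ℝ) < 2 ^ d := one_lt_pow₀ (by norm_num) (by omega)
  refine ⟨h / (8 * 2 ^ d), by positivity, fun n hn F hF hF1 => ?_⟩
  have hn' : (1 : ℝ) ≤ n := by exact_mod_cast hn
  obtain ⟨m, hm1, hm2⟩ := exists_nat_pow_near (x := 2 * (n : ℝ)) (by linarith) hB
  have hj : 1 ≤ m + 1 := by omega
  set B : ℝ := 2 ^ d with hBdef
  set Q := dyadicCube d (m + 1) 0
  have hQm : MeasurableSet Q := measurableSet_corner hj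
  have hp : (lamd d).real Q = (B ^ (m + 1))⁻¹ := by
    rw [lamd_real_corner hj, hBdef, ← pow_mul]
  have hc : |2 * ((1 + h) / 2) - 1| = h := by rw [abs_of_nonneg] <;> linarith
  have hc' : |2 * ((1 - h) / 2) - 1| = h := by rw [abs_of_nonpos] <;> linarith
  have hη := measurable_cornerEta (d := d) hj h ((1 + h) / 2)
  have hη' := measurable_cornerEta (d := d) hj h ((1 - h) / 2)
  have h01 := cornerEta_mem_Icc (d := d) (j := m + 1) hh.le hh1.le hc
  have h01' := cornerEta_mem_Icc (d := d) (j := m + 1) hh.le hh1.le hc'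
  have hprob := isProbabilityMeasure_uniformLaw hη h01
  have hprob' := isProbabilityMeasure_uniformLaw hη' h01'
  have hsum := le_excessExp_add_excessExp hη hη' h01 h01' hF hF1 hh.le hQm
    (fun x hx => by simp only [cornerEta]; rw [if_neg hx, if_neg hx])
    (fun x _ => (abs_two_mul_cornerEta_sub_one hh.le hc x).ge)
    (fun x _ => (abs_two_mul_cornerEta_sub_one hh.le hc' x).ge)
    (fun x hx => by rw [bayes_cornerEta hx, if_pos (by linarith)])
    (fun x hx => by rw [bayes_cornerEta hx, if_neg (by linarith)])
  have hbdd : BddAbove (Set.range fun p : ↥(Pclass d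
      (fun j => if j ≤ K then (2 : ℝ) ^ (d * j) else (2 : ℝ) ^ (d * K)) h a A) =>
        excessExp (p.1.1 : Measure (Pt d × ℝ)) p.1.2 n F) :=
    ⟨1, by rintro _ ⟨p, rfl⟩; exact excessExp_le_one _ _ _ _⟩
  have hle := le_ciSup hbdd
    ⟨_, uniformLaw_cornerEta_mem_Pclass hj hK hh.le hh1.le ha1 hA hc hprob⟩
  have hle' := le_ciSup hbdd
    ⟨_, uniformLaw_cornerEta_mem_Pclass hj hK hh.le hh1.le ha1 hA hc' hprob'⟩
  have hmass : (2 * n * B)⁻¹ ≤ (B ^ (m + 1))⁻¹ := by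
    rw [pow_succ]
    gcongr
  have hmass' : (n : ℝ) * (B ^ (m + 1))⁻¹ ≤ 1 / 2 := by
    rw [← div_eq_mul_inv, div_le_iff₀ (by positivity)]
    linarith
  have hp0 : 0 < (B ^ (m + 1))⁻¹ := by positivity
  have hp1 : (B ^ (m + 1))⁻¹ ≤ 1 := inv_le_one_of_one_le₀ (one_le_pow₀ hB.le)
  have hbern : 1 / 2 ≤ (1 - (B ^ (m + 1))⁻¹) ^ n := by
    have := one_add_mul_le_pow (a := -(B ^ (m + 1))⁻¹) (by linarith) n
    rw [← sub_eq_add_neg] at this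
    linarith
  rw [hp] at hsum
  have hlow : h * (2 * n * B)⁻¹ * (1 / 2) ≤ h * (B ^ (m + 1))⁻¹ * (1 - (B ^ (m + 1))⁻¹) ^ n := by
    gcongr
  have hC : h / (8 * B) / n = h * (2 * n * B)⁻¹ * (1 / 2) / 2 := by
    field_simp
    norm_num
  rw [hC]
  simp only [ProbabilityMeasure.coe_mk] at hle hle'
  linarith
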